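/- Fix integers C ≤ 0 and n. If a finite rooted tree T admits an admissible weighting of total charge n (with root-weight bound C), then the number of vertices of T satisfies |T| ≤ 2(n − C) + 1. In particular, up to isomorphism there are only finitely many rooted trees admitting an admissible weighting of total charge n. -/

import Mathlib

/-- A rooted tree is a finite partial order `T` with a unique minimal element `α` (the root)
such that for every `a` the set `{b | b < a}` is linearly ordered. Children of `a` are the
elements covering `a` (i.e. `a ⋖ b`). Given integers `C ≤ 0` and `n`, an admissible weighting
of total charge `n` is `c : T → ℤ` with `c a ≥ 0` for `a ≠ α`, any `a ≠ α` with `c a = 0`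
having at least two children, `c α ≥ C`, and total sum `n`.  If such a weighting exists then
`|T| ≤ 2(n - C) + 1`. -/
theorem stmt_0 (T : Type*) [Fintype T] [PartialOrder T]
    (α : T)
    (hroot_min : ∀ b : T, ¬ b < α)
    (hroot_uniq : ∀ a : T, (∀ b : T, ¬ b < a) → a = α)
    (hchain : ∀ a : T, IsChain (· ≤ ·) {b : T | b < a})
    (C n : ℤ) (hC : C ≤ 0)
    (c : T → ℤ)
    (hnonneg : ∀ a : T, a ≠ α → 0 ≤ c a)
    (hzero : ∀ a : T, a ≠ α → c a = 0 → 2 ≤ Nat.card {b : T | a ⋖ b})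
    (hα : C ≤ c α)
    (hsum : ∑ a : T, c a = n) :
    (Fintype.card T : ℤ) ≤ 2 * (n - C) + 1 := by
  classical
  -- the number of covering pairs is at most `|T| - 1`
  have hdisj : ∀ a₁ a₂ b : T, a₁ ⋖ b → a₂ ⋖ b → a₁ = a₂ := by
    intro a₁ a₂ b h₁ h₂
    by_contra hne
    rcases hchain b h₁.lt h₂.lt hne with h | h
    · exact h₁.2 (lt_of_le_of_ne h hne) h₂.lt
    · exact h₂.2 (lt_of_le_of_ne h (Ne.symm hne)) h₁.lt
  let ch : T → Finset T := fun a => Finset.univ.filter (fun b => a ⋖ b)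
  have hcard : ∀ a, Nat.card {b : T | a ⋖ b} = (ch a).card := by
    intro a
    rw [Nat.card_eq_fintype_card, Fintype.card_ofFinset]
    exact congrArg Finset.card (by ext b; simp [ch])
  have hle : ∑ a : T, (ch a).card ≤ (Finset.univ.erase α).card := by
    rw [← Finset.card_biUnion]
    · apply Finset.card_le_card
      intro b hb
      simp only [ch, Finset.mem_biUnion, Finset.mem_univ, true_and, Finset.mem_filter] at hb
      obtain ⟨a, ha⟩ := hb
      refine Finset.mem_erase.2 ⟨?_, Finset.mem_univ _⟩
      rintro rfl
      exact hroot_min a ha.lt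
    · intro a₁ _ a₂ _ hne
      rw [Function.onFun, Finset.disjoint_left]
      intro b h₁ h₂
      simp only [ch, Finset.mem_univ, true_and, Finset.mem_filter] at h₁ h₂
      exact hne (hdisj _ _ _ h₁ h₂)
  have herase : (Finset.univ.erase α).card + 1 = Fintype.card T :=
    Finset.card_erase_add_one (Finset.mem_univ α)
  have hlow : ∑ a ∈ Finset.univ.erase α, (2 : ℤ) ≤
      ∑ a ∈ Finset.univ.erase α, (2 * c a + ((ch a).card : ℤ)) := by
    apply Finset.sum_le_sum
    intro a ha
    have hne := (Finset.mem_erase.1 ha).1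
    have h0 := hnonneg a hne
    have hz := hzero a hne
    rw [hcard] at hz
    by_cases h : c a = 0
    · have := hz h
      omega
    · omega
  have htot := Finset.add_sum_erase Finset.univ (fun a => 2 * c a + ((ch a).card : ℤ))
    (Finset.mem_univ α)
  simp only [Finset.sum_const, nsmul_eq_mul] at hlow
  have hsplit : ∑ a : T, (2 * c a + ((ch a).card : ℤ)) = 2 * n + ∑ a : T, ((ch a).card : ℤ) := by
    rw [Finset.sum_add_distrib, ← Finset.mul_sum, hsum]
  have hle' : ∑ a : T, ((ch a).card : ℤ) ≤ ((Finset.univ.erase α).card : ℤ) := by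
    exact_mod_cast hle
  have herase' : ((Finset.univ.erase α).card : ℤ) + 1 = (Fintype.card T : ℤ) := by
    exact_mod_cast herase
  have hpos : (0 : ℤ) ≤ ((ch α).card : ℤ) := Int.natCast_nonneg _
  linarith
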